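/- arXiv:2409.12779 — 2 statements merged into one kernel-verified Lean document; each statement's English description precedes it below -/
import Mathlib

section
/- Let M = [[a, b], [c, d]] ∈ SL₂(ℝ) with a < 0, d < 0, b ≥ 0, c ≥ 0, and let n, m be integers with 0 < n < p and 0 < m < q. Then 1 = 2·(W(M, S_p^n U_q^m) + W(S_p^n, U_q^m)) - (sgn(M)/2)·(1 - sign(tr M)) + (sgn(M·S_p^n U_q^m)/2)·(1 - sign(tr(M·S_p^n U_q^m))), where sign : ℝ → {-1, 0, 1} is the usual sign function. -/
open Matrix Real

/-- `SL(2,ℝ)`. -/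
abbrev SL2R := Matrix.SpecialLinearGroup (Fin 2) ℝ

/-- The generator `S_p = [[0,-1],[1,2cos(π/p)]]` of the triangle group. -/
noncomputable def Sp (p : ℕ) : SL2R :=
  ⟨!![0, -1; 1, 2 * Real.cos (π / p)], by simp [Matrix.det_fin_two_of]⟩

/-- The generator `U_q = [[2cos(π/q),-1],[1,0]]` of the triangle group. -/
noncomputable def Uq (q : ℕ) : SL2R :=
  ⟨!![2 * Real.cos (π / q), -1; 1, 0], by simp [Matrix.det_fin_two_of]⟩

/-- The triangle group `Γ_{p,q}`, the subgroup of `SL(2,ℝ)` generated by `S_p` and `U_q`. -/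
noncomputable def TriangleGroup (p q : ℕ) : Subgroup SL2R :=
  Subgroup.closure {Sp p, Uq q}

/-- The sign `sgn(g)`: the sign of the lower-left entry if nonzero, otherwise
the sign of the lower-right entry. -/
noncomputable def sgn (g : SL2R) : ℝ :=
  if (g : Matrix (Fin 2) (Fin 2) ℝ) 1 0 ≠ 0 then Real.sign ((g : Matrix (Fin 2) (Fin 2) ℝ) 1 0)
  else Real.sign ((g : Matrix (Fin 2) (Fin 2) ℝ) 1 1)

/-- Asai's cocycle `W(g₁,g₂) = (sgn g₁ + sgn g₂ - sgn(g₁g₂) - sgn g₁ · sgn g₂ · sgn(g₁g₂))/4`. -/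
noncomputable def W (g₁ g₂ : SL2R) : ℝ :=
  (sgn g₁ + sgn g₂ - sgn (g₁ * g₂) - sgn g₁ * sgn g₂ * sgn (g₁ * g₂)) / 4

/-- The Chebyshev-like polynomials `C_n`, with `C_0 = 0`, `C_1 = 1` and
`C_{n+1}(x) = 2x C_n(x) - C_{n-1}(x)`, evaluated at `x`; namely `C_n = U_{n-1}`
with `U` the Chebyshev polynomial of the second kind. -/
noncomputable def Cheb (n : ℤ) (x : ℝ) : ℝ :=
  (Polynomial.Chebyshev.U ℝ (n - 1)).eval x

theorem Sp_pow_entries (p k : ℕ) :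
    Real.sin (π / p) * (Sp p ^ k : SL2R).1 0 0 = - Real.sin (((k : ℝ) - 1) * (π / p)) ∧
    Real.sin (π / p) * (Sp p ^ k : SL2R).1 0 1 = - Real.sin ((k : ℝ) * (π / p)) ∧
    Real.sin (π / p) * (Sp p ^ k : SL2R).1 1 0 = Real.sin ((k : ℝ) * (π / p)) ∧
    Real.sin (π / p) * (Sp p ^ k : SL2R).1 1 1 = Real.sin (((k : ℝ) + 1) * (π / p)) := by
  induction k with
  | zero => simp
  | succ k ih =>
    obtain ⟨h1, h2, h3, h4⟩ := ih
    have e0 : ((k : ℝ) - 1) * (π / p) = k * (π / p) - π / p := by ring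
    have e2 : ((k : ℝ) + 1) * (π / p) = k * (π / p) + π / p := by ring
    have e3 : ((k : ℝ) + 1 + 1) * (π / p) = k * (π / p) + π / p + π / p := by ring
    have hs := Real.sin_sq_add_cos_sq (π / p)
    rw [e0, Real.sin_sub] at h1
    rw [e2, Real.sin_add] at h4
    rw [pow_succ]
    push_cast
    rw [e3, e2]
    simp only [add_sub_cancel_right, Real.sin_add, Real.cos_add,
      Matrix.SpecialLinearGroup.coe_mul, Matrix.mul_apply, Fin.sum_univ_two]
    generalize Sp p ^ k = X at *
    simp only [Sp, Matrix.of_apply, Matrix.cons_val', Matrix.cons_val_zero, Matrix.cons_val_one,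
      Matrix.cons_val_fin_one]
    refine ⟨?_, ?_, ?_, ?_⟩
    · linear_combination h2
    · linear_combination -h1 + 2 * Real.cos (π / p) * h2
    · linear_combination h4
    · linear_combination -h3 + 2 * Real.cos (π / p) * h4 + Real.sin (k * (π / p)) * hs

theorem Uq_pow_entries (p k : ℕ) :
    Real.sin (π / p) * (Uq p ^ k : SL2R).1 0 0 = Real.sin (((k : ℝ) + 1) * (π / p)) ∧
    Real.sin (π / p) * (Uq p ^ k : SL2R).1 0 1 = - Real.sin ((k : ℝ) * (π / p)) ∧
    Real.sin (π / p) * (Uq p ^ k : SL2R).1 1 0 = Real.sin ((k : ℝ) * (π / p)) ∧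
    Real.sin (π / p) * (Uq p ^ k : SL2R).1 1 1 = - Real.sin (((k : ℝ) - 1) * (π / p)) := by
  induction k with
  | zero => simp
  | succ k ih =>
    obtain ⟨h1, h2, h3, h4⟩ := ih
    have e0 : ((k : ℝ) - 1) * (π / p) = k * (π / p) - π / p := by ring
    have e2 : ((k : ℝ) + 1) * (π / p) = k * (π / p) + π / p := by ring
    have e3 : ((k : ℝ) + 1 + 1) * (π / p) = k * (π / p) + π / p + π / p := by ring
    have hs := Real.sin_sq_add_cos_sq (π / p)
    rw [e0, Real.sin_sub] at h4
    rw [e2, Real.sin_add] at h1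
    rw [pow_succ]
    push_cast
    rw [e3, e2]
    simp only [add_sub_cancel_right, Real.sin_add, Real.cos_add,
      Matrix.SpecialLinearGroup.coe_mul, Matrix.mul_apply, Fin.sum_univ_two]
    generalize Uq p ^ k = X at *
    simp only [Uq, Matrix.of_apply, Matrix.cons_val', Matrix.cons_val_zero, Matrix.cons_val_one,
      Matrix.cons_val_fin_one]
    refine ⟨?_, ?_, ?_, ?_⟩
    · linear_combination h2 + 2 * Real.cos (π / p) * h1 + Real.sin (k * (π / p)) * hs
    · linear_combination -h1
    · linear_combination h4 + 2 * Real.cos (π / p) * h3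
    · linear_combination -h3

theorem sin_signs (p k : ℕ) (hk : 0 < k) (hkp : k < p) :
    0 < Real.sin (π / p) ∧ 0 ≤ Real.sin (((k : ℝ) - 1) * (π / p)) ∧
    0 < Real.sin ((k : ℝ) * (π / p)) ∧ 0 ≤ Real.sin (((k : ℝ) + 1) * (π / p)) := by
  have hp : (0 : ℝ) < p := by exact_mod_cast (by omega : 0 < p)
  have hk1 : (1 : ℝ) ≤ k := by exact_mod_cast hk
  have hk2 : (k : ℝ) + 1 ≤ p := by exact_mod_cast hkp
  have hθ : 0 < π / p := div_pos Real.pi_pos hp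
  have hpi : p * (π / p) = π := by field_simp
  refine ⟨Real.sin_pos_of_pos_of_lt_pi hθ (by nlinarith),
    Real.sin_nonneg_of_nonneg_of_le_pi (by nlinarith) (by nlinarith),
    Real.sin_pos_of_pos_of_lt_pi (by nlinarith) (by nlinarith),
    Real.sin_nonneg_of_nonneg_of_le_pi (by nlinarith) (by nlinarith)⟩

theorem Sp_signs (p k : ℕ) (hk : 0 < k) (hkp : k < p) :
    (Sp p ^ k : SL2R).1 0 0 ≤ 0 ∧ (Sp p ^ k : SL2R).1 0 1 < 0 ∧
    0 < (Sp p ^ k : SL2R).1 1 0 ∧ 0 ≤ (Sp p ^ k : SL2R).1 1 1 := by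
  obtain ⟨s, s0, s1, s2⟩ := sin_signs p k hk hkp
  obtain ⟨h1, h2, h3, h4⟩ := Sp_pow_entries p k
  refine ⟨?_, ?_, ?_, ?_⟩ <;> by_contra! h <;> nlinarith

theorem Uq_signs (p k : ℕ) (hk : 0 < k) (hkp : k < p) :
    0 ≤ (Uq p ^ k : SL2R).1 0 0 ∧ (Uq p ^ k : SL2R).1 0 1 < 0 ∧
    0 < (Uq p ^ k : SL2R).1 1 0 ∧ (Uq p ^ k : SL2R).1 1 1 ≤ 0 := by
  obtain ⟨s, s0, s1, s2⟩ := sin_signs p k hk hkp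
  obtain ⟨h1, h2, h3, h4⟩ := Uq_pow_entries p k
  refine ⟨?_, ?_, ?_, ?_⟩ <;> by_contra! h <;> nlinarith

theorem sgn_of_pos (g : SL2R) (h : 0 < g.1 1 0) : sgn g = 1 := by
  simp [sgn, h.ne', Real.sign_of_pos h]

theorem sgn_of_neg (g : SL2R) (h : g.1 1 0 < 0) : sgn g = -1 := by
  simp [sgn, h.ne, Real.sign_of_neg h]

theorem sgn_of_zero_pos (g : SL2R) (h : g.1 1 0 = 0) (h' : 0 < g.1 1 1) : sgn g = 1 := by
  simp [sgn, h, Real.sign_of_pos h']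

theorem sgn_of_zero_neg (g : SL2R) (h : g.1 1 0 = 0) (h' : g.1 1 1 < 0) : sgn g = -1 := by
  simp [sgn, h, Real.sign_of_neg h']

theorem SU_signs (S U : SL2R)
    (hS : S.1 0 0 ≤ 0 ∧ S.1 0 1 < 0 ∧ 0 < S.1 1 0 ∧ 0 ≤ S.1 1 1)
    (hU : 0 ≤ U.1 0 0 ∧ U.1 0 1 < 0 ∧ 0 < U.1 1 0 ∧ U.1 1 1 ≤ 0) :
    (S * U).1 0 0 < 0 ∧ 0 ≤ (S * U).1 0 1 ∧ 0 ≤ (S * U).1 1 0 ∧ (S * U).1 1 1 < 0 := by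
  obtain ⟨a1, a2, a3, a4⟩ := hS
  obtain ⟨b1, b2, b3, b4⟩ := hU
  simp only [Matrix.SpecialLinearGroup.coe_mul, Matrix.mul_apply, Fin.sum_univ_two]
  refine ⟨?_, ?_, ?_, ?_⟩ <;> nlinarith

theorem core_identity (M N S U : SL2R) (hN : N = S * U)
    (ha : M.1 0 0 < 0) (hd : M.1 1 1 < 0) (hb : 0 ≤ M.1 0 1) (hc : 0 ≤ M.1 1 0)
    (hS : 0 < S.1 1 0) (hU : 0 < U.1 1 0)
    (hA : N.1 0 0 < 0) (hB : 0 ≤ N.1 0 1) (hC : 0 ≤ N.1 1 0) (hD : N.1 1 1 < 0) :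
    (1 : ℝ) = 2 * (W M N + W S U)
      - sgn M / 2 * (1 - Real.sign (Matrix.trace M.1))
      + sgn (M * N) / 2 * (1 - Real.sign (Matrix.trace (M * N).1)) := by
  have e00 : (M * N).1 0 0 = M.1 0 0 * N.1 0 0 + M.1 0 1 * N.1 1 0 := by
    simp only [Matrix.SpecialLinearGroup.coe_mul, Matrix.mul_apply, Fin.sum_univ_two]
  have e10 : (M * N).1 1 0 = M.1 1 0 * N.1 0 0 + M.1 1 1 * N.1 1 0 := by
    simp only [Matrix.SpecialLinearGroup.coe_mul, Matrix.mul_apply, Fin.sum_univ_two]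
  have e11 : (M * N).1 1 1 = M.1 1 0 * N.1 0 1 + M.1 1 1 * N.1 1 1 := by
    simp only [Matrix.SpecialLinearGroup.coe_mul, Matrix.mul_apply, Fin.sum_univ_two]
  have p11 : 0 < (M * N).1 1 1 := by rw [e11]; nlinarith
  have t1 : Real.sign (Matrix.trace M.1) = -1 := by
    rw [Matrix.trace_fin_two]; exact Real.sign_of_neg (by linarith)
  have t2 : Real.sign (Matrix.trace (M * N).1) = 1 := by
    rw [Matrix.trace_fin_two]; exact Real.sign_of_pos (by nlinarith)
  rw [t1, t2, W, W, ← hN, sgn_of_pos S hS, sgn_of_pos U hU]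
  rcases hc.eq_or_lt with h1 | h1 <;> rcases hC.eq_or_lt with h2 | h2
  · rw [sgn_of_zero_neg M h1.symm hd, sgn_of_zero_neg N h2.symm hD,
      sgn_of_zero_pos (M * N) (by rw [e10, ← h1, ← h2]; ring) p11]
    norm_num
  · rw [sgn_of_zero_neg M h1.symm hd, sgn_of_pos N h2,
      sgn_of_neg (M * N) (by rw [e10]; nlinarith)]
    norm_num
  · rw [sgn_of_pos M h1, sgn_of_zero_neg N h2.symm hD,
      sgn_of_neg (M * N) (by rw [e10]; nlinarith)]
    norm_num
  · rw [sgn_of_pos M h1, sgn_of_pos N h2,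
      sgn_of_neg (M * N) (by rw [e10]; nlinarith)]
    norm_num

/-- The key identity
`1 = 2(W(M, S_p^n U_q^m) + W(S_p^n, U_q^m)) - (sgn M / 2)(1 - sign(tr M))
+ (sgn(M S_p^n U_q^m)/2)(1 - sign(tr(M S_p^n U_q^m)))`
for `M` with negative diagonal and nonnegative off-diagonal entries. -/
theorem key_identity (p q : ℕ) (hp : 2 ≤ p) (hpq : p < q) (hco : Nat.Coprime p q)
    (M : SL2R)
    (ha : (M : Matrix (Fin 2) (Fin 2) ℝ) 0 0 < 0) (hd : (M : Matrix (Fin 2) (Fin 2) ℝ) 1 1 < 0)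
    (hb : 0 ≤ (M : Matrix (Fin 2) (Fin 2) ℝ) 0 1) (hc : 0 ≤ (M : Matrix (Fin 2) (Fin 2) ℝ) 1 0)
    (n m : ℤ) (hn0 : 0 < n) (hnp : n < p) (hm0 : 0 < m) (hmq : m < q) :
    (1 : ℝ) = 2 * (W M (Sp p ^ n * Uq q ^ m) + W (Sp p ^ n) (Uq q ^ m))
      - sgn M / 2 * (1 - Real.sign (Matrix.trace ((M : SL2R) : Matrix (Fin 2) (Fin 2) ℝ)))
      + sgn (M * (Sp p ^ n * Uq q ^ m)) / 2 *
        (1 - Real.sign (Matrix.trace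
          ((M * (Sp p ^ n * Uq q ^ m) : SL2R) : Matrix (Fin 2) (Fin 2) ℝ))) := by
  lift n to ℕ using hn0.le
  lift m to ℕ using hm0.le
  simp only [zpow_natCast]
  have hS := Sp_signs p n (by omega) (by omega)
  have hU := Uq_signs q m (by omega) (by omega)
  obtain ⟨hA, hB, hC, hD⟩ := SU_signs _ _ hS hU
  exact core_identity M _ _ _ rfl ha hd hb hc hS.2.2.1 hU.2.2.1 hA hB hC hD
end

section
/- Suppose ψ : Γ_{p,q} → ℤ satisfies ψ(γ₁γ₂) = ψ(γ₁) + ψ(γ₂) + 2pq·W(γ₁, γ₂) for all γ₁, γ₂ ∈ Γ_{p,q}. Let r ≥ 1, let M = S_p^{n₁} U_q^{m₁} ⋯ S_p^{n_r} U_q^{m_r} with integers 0 < n_j < p and 0 < m_j < q satisfy Ψ_{p,q}(M) = Σ_{j=1}^r (pq - q·n_j - p·m_j), and assume the diagonal entries of M are negative and its off-diagonal entries are ≥ 0. Then for any integers n, m with 0 < n < p and 0 < m < q, one has Ψ_{p,q}(M·S_p^n U_q^m) = Σ_{j=1}^r (pq - q·n_j - p·m_j) + (pq - q·n - p·m). 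-/
open Matrix Real

/-- The Rademacher symbol `Ψ_{p,q}(γ) = ψ(γ) + (pq/2)·sgn(γ)·(1 - sign(tr γ))` attached
to a function `ψ : Γ_{p,q} → ℤ`. -/
noncomputable def Psi (p q : ℕ) (ψ : TriangleGroup p q → ℤ) (γ : TriangleGroup p q) : ℝ :=
  (ψ γ : ℝ) + (p * q : ℝ) / 2 * sgn (γ : SL2R) *
    (1 - Real.sign (Matrix.trace ((γ : SL2R) : Matrix (Fin 2) (Fin 2) ℝ)))

noncomputable def sf (θ x : ℝ) : ℝ := Real.sin (x * θ) / Real.sin θ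

lemma sf_rec (θ x : ℝ) : sf θ (x + 1) = 2 * Real.cos θ * sf θ x - sf θ (x - 1) := by
  unfold sf
  rw [add_mul, sub_mul, one_mul, Real.sin_add, Real.sin_sub]
  ring

lemma sf_zero (θ : ℝ) : sf θ 0 = 0 := by simp [sf]

lemma sf_one (θ : ℝ) (h : Real.sin θ ≠ 0) : sf θ 1 = 1 := by simp [sf, h]

lemma sin_pos_N (N : ℕ) (hN : 2 ≤ N) : 0 < Real.sin (π / N) := by
  have h : (2 : ℝ) ≤ N := by exact_mod_cast hN
  apply Real.sin_pos_of_pos_of_lt_pi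
  · have := Real.pi_pos
    positivity
  · rw [div_lt_iff₀ (by linarith)]
    nlinarith [Real.pi_pos]

lemma sf_nonneg (N : ℕ) (hN : 2 ≤ N) (x : ℝ) (h0 : 0 ≤ x) (h1 : x ≤ N) :
    0 ≤ sf (π / N) x := by
  have h : (2 : ℝ) ≤ N := by exact_mod_cast hN
  have := Real.pi_pos
  apply div_nonneg _ (sin_pos_N N hN).le
  apply Real.sin_nonneg_of_nonneg_of_le_pi
  · positivity
  · rw [mul_div_assoc', div_le_iff₀ (by linarith)]
    nlinarith

lemma sf_pos (N : ℕ) (hN : 2 ≤ N) (x : ℝ) (h0 : 0 < x) (h1 : x < N) :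
    0 < sf (π / N) x := by
  have h : (2 : ℝ) ≤ N := by exact_mod_cast hN
  have := Real.pi_pos
  apply div_pos _ (sin_pos_N N hN)
  apply Real.sin_pos_of_pos_of_lt_pi
  · positivity
  · rw [mul_div_assoc', div_lt_iff₀ (by linarith)]
    nlinarith

lemma sf_N (N : ℕ) (hN : 2 ≤ N) : sf (π / N) N = 0 := by
  have h : (N : ℝ) ≠ 0 := by positivity
  unfold sf
  rw [mul_div_cancel₀ _ h]; simp

lemma sf_N_add (N : ℕ) (hN : 2 ≤ N) : sf (π / N) (N + 1) = -1 := by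
  have h : (N : ℝ) ≠ 0 := by positivity
  have h2 := (sin_pos_N N hN).ne'
  unfold sf
  rw [add_mul, mul_div_cancel₀ _ h, one_mul, add_comm, Real.sin_add_pi, neg_div, div_self h2]

lemma sf_N_sub (N : ℕ) (hN : 2 ≤ N) : sf (π / N) (N - 1) = 1 := by
  have := sf_rec (π / N) N
  rw [sf_N N hN, sf_N_add N hN] at this
  linarith

lemma Sp_pow (p : ℕ) (hp : 2 ≤ p) (n : ℕ) :
    ((Sp p ^ n : SL2R) : Matrix (Fin 2) (Fin 2) ℝ) =
      !![-sf (π / p) (n - 1), -sf (π / p) n; sf (π / p) n, sf (π / p) (n + 1)] := by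
  have h2 := (sin_pos_N p hp).ne'
  induction n with
  | zero =>
    have h := sf_rec (π / p) 0
    simp only [zero_add, sf_zero, sf_one _ h2] at h
    ext i j
    fin_cases i <;> fin_cases j <;> simp [sf_zero, sf_one _ h2] <;> norm_num at h ⊢ <;> linarith
  | succ n ih =>
    have h := sf_rec (π / p) n
    have h' := sf_rec (π / p) (n + 1)
    rw [add_sub_cancel_right] at h'
    rw [pow_succ, Matrix.SpecialLinearGroup.coe_mul, ih, Sp]
    ext i j
    fin_cases i <;> fin_cases j <;> simp [Matrix.mul_apply, Fin.sum_univ_two] <;> linarith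

lemma Uq_pow (q : ℕ) (hq : 2 ≤ q) (n : ℕ) :
    ((Uq q ^ n : SL2R) : Matrix (Fin 2) (Fin 2) ℝ) =
      !![sf (π / q) (n + 1), -sf (π / q) n; sf (π / q) n, -sf (π / q) (n - 1)] := by
  have h2 := (sin_pos_N q hq).ne'
  induction n with
  | zero =>
    have h := sf_rec (π / q) 0
    simp only [zero_add, sf_zero, sf_one _ h2] at h
    ext i j
    fin_cases i <;> fin_cases j <;> simp [sf_zero, sf_one _ h2] <;> norm_num at h ⊢ <;> linarith
  | succ n ih =>
    have h := sf_rec (π / q) n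
    have h' := sf_rec (π / q) (n + 1)
    rw [add_sub_cancel_right] at h'
    rw [pow_succ, Matrix.SpecialLinearGroup.coe_mul, ih, Uq]
    ext i j
    fin_cases i <;> fin_cases j <;> simp [Matrix.mul_apply, Fin.sum_univ_two] <;> linarith

lemma sgn_pos (g : SL2R) (h : 0 < (g : Matrix (Fin 2) (Fin 2) ℝ) 1 0) : sgn g = 1 := by
  rw [sgn, if_pos h.ne', Real.sign_of_pos h]

lemma sgn_neg (g : SL2R) (h : (g : Matrix (Fin 2) (Fin 2) ℝ) 1 0 < 0) : sgn g = -1 := by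
  rw [sgn, if_pos h.ne, Real.sign_of_neg h]

lemma sgn_zero_neg (g : SL2R) (h : (g : Matrix (Fin 2) (Fin 2) ℝ) 1 0 = 0)
    (h' : (g : Matrix (Fin 2) (Fin 2) ℝ) 1 1 < 0) : sgn g = -1 := by
  rw [sgn, if_neg (by simp [h]), Real.sign_of_neg h']

lemma sgn_zero_pos (g : SL2R) (h : (g : Matrix (Fin 2) (Fin 2) ℝ) 1 0 = 0)
    (h' : 0 < (g : Matrix (Fin 2) (Fin 2) ℝ) 1 1) : sgn g = 1 := by
  rw [sgn, if_neg (by simp [h]), Real.sign_of_pos h']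

lemma Sp_pow_sgn (p : ℕ) (hp : 2 ≤ p) (n : ℕ) (h0 : 0 < n) (h1 : n < p) :
    sgn (Sp p ^ n) = 1 := by
  apply sgn_pos
  rw [Sp_pow p hp]
  simpa using sf_pos p hp n (by exact_mod_cast h0) (by exact_mod_cast h1)

lemma Uq_pow_sgn (p : ℕ) (hp : 2 ≤ p) (n : ℕ) (h0 : 0 < n) (h1 : n < p) :
    sgn (Uq p ^ n) = 1 := by
  apply sgn_pos
  rw [Uq_pow p hp]
  simpa using sf_pos p hp n (by exact_mod_cast h0) (by exact_mod_cast h1)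

lemma Sp_pow_N (p : ℕ) (hp : 2 ≤ p) : Sp p ^ p = -1 := by
  apply Subtype.ext
  rw [Sp_pow p hp]
  ext i j
  fin_cases i <;> fin_cases j <;> simp [sf_N p hp, sf_N_add p hp, sf_N_sub p hp]

lemma Uq_pow_N (p : ℕ) (hp : 2 ≤ p) : Uq p ^ p = -1 := by
  apply Subtype.ext
  rw [Uq_pow p hp]
  ext i j
  fin_cases i <;> fin_cases j <;> simp [sf_N p hp, sf_N_add p hp, sf_N_sub p hp]

lemma sgn_one : sgn 1 = 1 := sgn_zero_pos _ (by simp) (by simp)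
lemma sgn_neg_one : sgn (-1) = -1 := sgn_zero_neg _ (by simp) (by simp)

lemma psi_gen (p q : ℕ) (ψ : TriangleGroup p q → ℤ)
    (hψ : ∀ γ₁ γ₂ : TriangleGroup p q,
      (ψ (γ₁ * γ₂) : ℝ) = ψ γ₁ + ψ γ₂ + 2 * p * q * W (γ₁ : SL2R) (γ₂ : SL2R))
    (g : TriangleGroup p q) (N : ℕ) (hN : 2 ≤ N)
    (hs : ∀ n, 0 < n → n < N → sgn ((g : SL2R) ^ n) = 1) (hg : (g : SL2R) ^ N = -1) :
    (N : ℝ) * ψ g = -(p * q) ∧ ∀ n, 0 < n → n < N → (ψ (g ^ n) : ℝ) = n * ψ g := by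
  have hg1 : sgn (g : SL2R) = 1 := by simpa using hs 1 (by omega) (by omega)
  have key : ∀ n, 0 < n → n < N → (ψ (g ^ n) : ℝ) = n * ψ g := by
    intro n h0
    induction n, h0 using Nat.le_induction with
    | base => simp
    | succ n hn ih =>
      intro h
      rw [pow_succ, hψ, ih (by omega), W, SubgroupClass.coe_pow, ← pow_succ,
        hs n (by omega) (by omega), hs (n + 1) (by omega) h, hg1]
      push_cast; ring
  refine ⟨?_, key⟩
  have h1 : (ψ 1 : ℝ) = 0 := by
    have := hψ 1 1
    rw [W, mul_one, OneMemClass.coe_one, mul_one, sgn_one] at this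
    linarith
  obtain ⟨k, rfl⟩ : ∃ k, N = k + 1 := ⟨N - 1, by omega⟩
  have h2 : (ψ (g ^ (k + 1)) : ℝ) = (k + 1) * ψ g + 2 * p * q := by
    rw [pow_succ, hψ, key k (by omega) (by omega), W, SubgroupClass.coe_pow, ← pow_succ,
      hs k (by omega) (by omega), hg, hg1, sgn_neg_one]
    push_cast; ring
  have h3 := hψ (g ^ (k + 1)) (g ^ (k + 1))
  have h4 : g ^ (k + 1) * g ^ (k + 1) = 1 := by
    apply Subtype.ext
    rw [Subgroup.coe_mul, SubgroupClass.coe_pow, hg]; simp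
  rw [h4, h1, h2, W, SubgroupClass.coe_pow, hg, neg_mul_neg, one_mul, sgn_one, sgn_neg_one] at h3
  push_cast
  linarith

/-- Induction step: if `M = S_p^{n₁}U_q^{m₁} ⋯ S_p^{n_r}U_q^{m_r}` satisfies
`Ψ_{p,q}(M) = Σ_j (pq - q n_j - p m_j)` and has negative diagonal and nonnegative
off-diagonal entries, then `Ψ_{p,q}(M S_p^n U_q^m) = Σ_j (pq - q n_j - p m_j) + (pq - qn - pm)`. -/
theorem Psi_step (p q : ℕ) (hp : 2 ≤ p) (hpq : p < q) (hco : Nat.Coprime p q)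
    (ψ : TriangleGroup p q → ℤ)
    (hψ : ∀ γ₁ γ₂ : TriangleGroup p q,
      (ψ (γ₁ * γ₂) : ℝ) = ψ γ₁ + ψ γ₂ + 2 * p * q * W (γ₁ : SL2R) (γ₂ : SL2R))
    (r : ℕ) (hr : 1 ≤ r) (nseq mseq : ℕ → ℤ)
    (hn : ∀ j < r, 0 < nseq j ∧ nseq j < p) (hm : ∀ j < r, 0 < mseq j ∧ mseq j < q)
    (M : TriangleGroup p q)
    (hMdef : (M : SL2R) = ((List.range r).map fun j => Sp p ^ nseq j * Uq q ^ mseq j).prod)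
    (hPsiM : Psi p q ψ M = ∑ j ∈ Finset.range r, ((p * q : ℝ) - q * nseq j - p * mseq j))
    (ha : ((M : SL2R) : Matrix (Fin 2) (Fin 2) ℝ) 0 0 < 0)
    (hd : ((M : SL2R) : Matrix (Fin 2) (Fin 2) ℝ) 1 1 < 0)
    (hb : 0 ≤ ((M : SL2R) : Matrix (Fin 2) (Fin 2) ℝ) 0 1)
    (hc : 0 ≤ ((M : SL2R) : Matrix (Fin 2) (Fin 2) ℝ) 1 0)
    (n m : ℤ) (hn0 : 0 < n) (hnp : n < p) (hm0 : 0 < m) (hmq : m < q)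
    (S : TriangleGroup p q) (hS : (S : SL2R) = Sp p ^ n * Uq q ^ m) :
    Psi p q ψ (M * S) =
      ∑ j ∈ Finset.range r, ((p * q : ℝ) - q * nseq j - p * mseq j)
        + ((p * q : ℝ) - q * n - p * m) := by
  have hq : 2 ≤ q := by omega
  have hp' : (2 : ℝ) ≤ p := by exact_mod_cast hp
  have hq' : (2 : ℝ) ≤ q := by exact_mod_cast hq
  lift n to ℕ using hn0.le
  lift m to ℕ using hm0.le
  norm_cast at hn0 hnp hm0 hmq
  rw [zpow_natCast, zpow_natCast] at hS
  let s : TriangleGroup p q := ⟨Sp p, Subgroup.subset_closure (by simp)⟩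
  let u : TriangleGroup p q := ⟨Uq q, Subgroup.subset_closure (by simp)⟩
  obtain ⟨hs1, hs2⟩ := psi_gen p q ψ hψ s p hp (Sp_pow_sgn p hp) (Sp_pow_N p hp)
  obtain ⟨hu1, hu2⟩ := psi_gen p q ψ hψ u q hq (Uq_pow_sgn q hq) (Uq_pow_N q hq)
  have hs3 : (ψ s : ℝ) = -q := by
    apply mul_left_cancel₀ (a := (p : ℝ)) (by positivity)
    linarith
  have hu3 : (ψ u : ℝ) = -p := by
    apply mul_left_cancel₀ (a := (q : ℝ)) (by positivity)
    linarith
  have hSeq : S = s ^ n * u ^ m := Subtype.ext hS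
  have hψS : (ψ S : ℝ) = -(q * n) - p * m + p * q * (1 - sgn (S : SL2R)) := by
    have hmul := hψ (s ^ n) (u ^ m)
    have e1 : ((s ^ n : TriangleGroup p q) : SL2R) = Sp p ^ n := rfl
    have e2 : ((u ^ m : TriangleGroup p q) : SL2R) = Uq q ^ m := rfl
    rw [← hSeq, hs2 n hn0 hnp, hu2 m hm0 hmq, hs3, hu3, W, e1, e2, ← hS,
      Sp_pow_sgn p hp n hn0 hnp, Uq_pow_sgn q hq m hm0 hmq] at hmul
    rw [hmul]; ring
  have hn0' : (1 : ℝ) ≤ n := by exact_mod_cast hn0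
  have hm0' : (1 : ℝ) ≤ m := by exact_mod_cast hm0
  have hnp' : (n : ℝ) + 1 ≤ p := by exact_mod_cast hnp
  have hmq' : (m : ℝ) + 1 ≤ q := by exact_mod_cast hmq
  have hSm : ((S : SL2R) : Matrix (Fin 2) (Fin 2) ℝ) =
      !![-sf (π / p) (n - 1), -sf (π / p) n; sf (π / p) n, sf (π / p) (n + 1)] *
      !![sf (π / q) (m + 1), -sf (π / q) m; sf (π / q) m, -sf (π / q) (m - 1)] := by
    rw [hS, Matrix.SpecialLinearGroup.coe_mul, Sp_pow p hp, Uq_pow q hq]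
  have s0 := sf_nonneg p hp (n - 1) (by linarith) (by linarith)
  have s1 := sf_pos p hp n (by linarith) (by linarith)
  have s2 := sf_nonneg p hp (n + 1) (by linarith) (by linarith)
  have t0 := sf_nonneg q hq (m - 1) (by linarith) (by linarith)
  have t1 := sf_pos q hq m (by linarith) (by linarith)
  have t2 := sf_nonneg q hq (m + 1) (by linarith) (by linarith)
  have ha' : ((S : SL2R) : Matrix (Fin 2) (Fin 2) ℝ) 0 0 < 0 := by
    rw [hSm]; simp [Matrix.mul_apply, Fin.sum_univ_two]
    linarith [mul_pos s1 t1, mul_nonneg s0 t2]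
  have hd' : ((S : SL2R) : Matrix (Fin 2) (Fin 2) ℝ) 1 1 < 0 := by
    rw [hSm]; simp [Matrix.mul_apply, Fin.sum_univ_two]
    linarith [mul_pos s1 t1, mul_nonneg s2 t0]
  have hb' : 0 ≤ ((S : SL2R) : Matrix (Fin 2) (Fin 2) ℝ) 0 1 := by
    rw [hSm]; simp [Matrix.mul_apply, Fin.sum_univ_two]
    linarith [mul_nonneg s1.le t0, mul_nonneg s0 t1.le]
  have hc' : 0 ≤ ((S : SL2R) : Matrix (Fin 2) (Fin 2) ℝ) 1 0 := by
    rw [hSm]; simp [Matrix.mul_apply, Fin.sum_univ_two]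
    linarith [mul_nonneg s1.le t2, mul_nonneg s2 t1.le]
  have hmat : ∀ i j, ((M * S : SL2R) : Matrix (Fin 2) (Fin 2) ℝ) i j =
      ((M : SL2R) : Matrix (Fin 2) (Fin 2) ℝ) i 0 * ((S : SL2R) : Matrix (Fin 2) (Fin 2) ℝ) 0 j +
      ((M : SL2R) : Matrix (Fin 2) (Fin 2) ℝ) i 1 * ((S : SL2R) : Matrix (Fin 2) (Fin 2) ℝ) 1 j := by
    intro i j
    rw [Matrix.SpecialLinearGroup.coe_mul, Matrix.mul_apply, Fin.sum_univ_two]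
  have p00 : 0 < ((M * S : SL2R) : Matrix (Fin 2) (Fin 2) ℝ) 0 0 := by
    rw [hmat]; linarith [mul_pos_of_neg_of_neg ha ha', mul_nonneg hb hc']
  have p11 : 0 < ((M * S : SL2R) : Matrix (Fin 2) (Fin 2) ℝ) 1 1 := by
    rw [hmat]; linarith [mul_pos_of_neg_of_neg hd hd', mul_nonneg hc hb']
  have hW : W (M : SL2R) (S : SL2R) = (sgn (M : SL2R) + sgn (S : SL2R)) / 2 := by
    rw [W]
    rcases hc.lt_or_eq with h1 | h1 <;> rcases hc'.lt_or_eq with h2 | h2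
    · have h3 : ((M * S : SL2R) : Matrix (Fin 2) (Fin 2) ℝ) 1 0 < 0 := by
        rw [hmat]; linarith [mul_neg_of_pos_of_neg h1 ha', mul_neg_of_neg_of_pos hd h2]
      rw [sgn_neg _ h3, sgn_pos _ h1, sgn_pos _ h2]; norm_num
    · rw [sgn_pos _ h1, sgn_zero_neg _ h2.symm hd']; ring
    · rw [sgn_pos _ h2, sgn_zero_neg _ h1.symm hd]; ring
    · have h3 : ((M * S : SL2R) : Matrix (Fin 2) (Fin 2) ℝ) 1 0 = 0 := by
        rw [hmat, ← h1, ← h2]; ring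
      rw [sgn_zero_pos _ h3 p11, sgn_zero_neg _ h1.symm hd, sgn_zero_neg _ h2.symm hd']; norm_num
  rw [← hPsiM, Psi, Psi, hψ, hW, hψS, Subgroup.coe_mul, Matrix.trace_fin_two,
    Matrix.trace_fin_two, Real.sign_of_pos (add_pos p00 p11), Real.sign_of_neg (add_neg ha hd)]
  push_cast
  ring
end
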